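/- Under Assumption (A), if the routing matrix P has a branching structure, then the vector ρ = (ρ_1,…,ρ_d) with ρ_i = G_{ii} satisfies Σ_{j=1}^d G_{jj} p_{ji} ≤ G_{ii} for every i = 1,…,d; that is, (ρP)_i ≤ ρ_i and ρ_i > 0 for all i. -/

import Mathlib

open scoped BigOperators
open Filter

/-- The `i`-th standard unit vector in `ℤ^d`. -/
def unitZ {d : ℕ} (i : Fin d) : Fin d → ℤ := fun k => if k = i then 1 else 0

/-- The jump rates `q(y)` of the Jackson network: `q(ε^i) = λ_i`,
`q(-ε^i) = μ_i p_{i0}`, `q(ε^j - ε^i) = μ_i p_{ij}` and `q(y) = 0` otherwise. -/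
noncomputable def qrate {d : ℕ} (lam mu : Fin d → ℝ) (P : Fin d → Fin d → ℝ)
    (y : Fin d → ℤ) : ℝ :=
  (∑ i, lam i * (if y = unitZ i then 1 else 0))
    + (∑ i, mu i * (1 - ∑ j, P i j) * (if y = -unitZ i then 1 else 0))
    + (∑ i, ∑ j, mu i * P i j * (if y = unitZ j - unitZ i then 1 else 0))

/-- Assumption (A): irreducibility of the matrix `(q(x - y); x, y ∈ ℤ^d)`. -/
def AssumptionA {d : ℕ} (lam mu : Fin d → ℝ) (P : Fin d → Fin d → ℝ) : Prop :=
  ∀ x y : Fin d → ℤ, ∃ (n : ℕ) (c : Fin (n + 1) → Fin d → ℤ),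
    c 0 = x ∧ c (Fin.last n) = y ∧
      ∀ k : Fin n, 0 < qrate lam mu P (c k.succ - c k.castSucc)

/-- The generator `ℒ` of the Jackson network:
`(ℒ f)(x) = ∑_{z ∈ ℤ_+^d} q(z - x) (f z - f x)`. -/
noncomputable def gen {d : ℕ} (lam mu : Fin d → ℝ) (P : Fin d → Fin d → ℝ)
    (f : (Fin d → ℕ) → ℝ) (x : Fin d → ℕ) : ℝ :=
  ∑' z : Fin d → ℕ, qrate lam mu P (fun k => (z k : ℤ) - (x k : ℤ)) * (f z - f x)

/-- The hitting-probability matrix `Q j i = G j i / G i i`. -/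
noncomputable def hitQ {d : ℕ} (G : Fin d → Fin d → ℝ) : Fin d → Fin d → ℝ :=
  fun j i => G j i / G i i

/-- The vector `γ⃗_i`, with components `γ_i^j = log (1 + Q j i * γ i)`. -/
noncomputable def gvec {d : ℕ} (Q : Fin d → Fin d → ℝ) (γ : Fin d → ℝ) (i j : Fin d) : ℝ :=
  Real.log (1 + Q j i * γ i)

/-- The set `Γ`: all `γ ∈ ℝ_+^d` such that for every `i` and every nonzero
`v ∈ ℝ_+^d` with `v i = 0` one has `γ⃗_i ⬝ v < max_j γ⃗_j ⬝ v`. -/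
def GammaSet (d : ℕ) (Q : Fin d → Fin d → ℝ) : Set (Fin d → ℝ) :=
  {γ | (∀ i, 0 ≤ γ i) ∧
    ∀ i : Fin d, ∀ v : Fin d → ℝ, (∀ j, 0 ≤ v j) → v ≠ 0 → v i = 0 →
      (∑ j, gvec Q γ i j * v j) < ⨆ l : Fin d, ∑ j, gvec Q γ l j * v j}

/-- A matrix A = (a_{ji}) has a branching structure if for every i the set
{j : a_{ji} > 0} contains at most one element. -/
def Branching {d : ℕ} (P : Fin d → Fin d → ℝ) : Prop :=
  ∀ i j k : Fin d, 0 < P j i → 0 < P k i → j = k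

/-- If `G ≥ 0` is a left inverse of `Id - P`, every subharmonic function is nonpositive. -/
theorem nonpos_of_subharmonic {ι : Type*} [Fintype ι] [DecidableEq ι] {P G : ι → ι → ℝ}
    (hG : ∀ i k, ∑ j, G i j * ((if j = k then (1 : ℝ) else 0) - P j k) = if i = k then 1 else 0)
    (hGnn : ∀ i j, 0 ≤ G i j) {g : ι → ℝ} (hg : ∀ k, g k ≤ ∑ l, P k l * g l) (k : ι) :
    g k ≤ 0 := by
  have h : g k = ∑ j, G k j * (g j - ∑ l, P j l * g l) := by
    calc g k = ∑ l, (if k = l then (1 : ℝ) else 0) * g l := by simp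
      _ = ∑ l, (∑ j, G k j * ((if j = l then (1 : ℝ) else 0) - P j l)) * g l := by
          simp only [hG]
      _ = ∑ j, ∑ l, G k j * ((if j = l then (1 : ℝ) else 0) - P j l) * g l := by
          simp only [Finset.sum_mul]
          exact Finset.sum_comm
      _ = ∑ j, G k j * (g j - ∑ l, P j l * g l) := by
          refine Finset.sum_congr rfl fun j _ => ?_
          simp only [mul_assoc, ← Finset.mul_sum, sub_mul, Finset.sum_sub_distrib, ite_mul,
            one_mul, zero_mul, Finset.sum_ite_eq, Finset.mem_univ, if_true]
  rw [h]
  exact Finset.sum_nonpos fun j _ =>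
    mul_nonpos_of_nonneg_of_nonpos (hGnn k j) (sub_nonpos.2 (hg j))

/-- The Green function of a substochastic matrix is maximal on the diagonal of each column. -/
theorem green_le_diag {ι : Type*} [Fintype ι] [DecidableEq ι] {P G : ι → ι → ℝ}
    (hP : ∀ i j, 0 ≤ P i j) (hP0 : ∀ i, ∑ j, P i j ≤ 1)
    (hG1 : ∀ i k, ∑ j, G i j * ((if j = k then (1 : ℝ) else 0) - P j k) = if i = k then 1 else 0)
    (hG2 : ∀ i k, ∑ j, ((if i = j then (1 : ℝ) else 0) - P i j) * G j k = if i = k then 1 else 0)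
    (hGnn : ∀ i j, 0 ≤ G i j) (k i : ι) : G k i ≤ G i i := by
  have key : max (G k i - G i i) 0 ≤ 0 := by
    refine nonpos_of_subharmonic (g := fun k => max (G k i - G i i) 0) hG1 hGnn (fun m => ?_) k
    have hnn : 0 ≤ ∑ l, P m l * max (G l i - G i i) 0 :=
      Finset.sum_nonneg fun l _ => mul_nonneg (hP m l) (le_max_right _ _)
    refine max_le ?_ hnn
    rcases eq_or_ne m i with rfl | hmi
    · simpa using hnn
    have hm : G m i = ∑ l, P m l * G l i := by
      have h := hG2 m i
      simp only [sub_mul, Finset.sum_sub_distrib, ite_mul, one_mul, zero_mul, Finset.sum_ite_eq,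
        Finset.mem_univ, if_true, if_neg hmi] at h
      linarith
    have hle : ∑ l, P m l * (G l i - G i i) ≤ ∑ l, P m l * max (G l i - G i i) 0 :=
      Finset.sum_le_sum fun l _ => mul_le_mul_of_nonneg_left (le_max_left _ _) (hP m l)
    simp only [mul_sub, Finset.sum_sub_distrib, ← Finset.sum_mul, ← hm] at hle
    have hc : (∑ l, P m l) * G i i ≤ G i i := mul_le_of_le_one_left (hGnn i i) (hP0 m)
    linarith
  linarith [le_max_left (G k i - G i i) 0]

/-- If the routing matrix has a branching structure, then the vector ρ with
ρ_i = G_ii satisfies Σ_j G_jj p_{ji} ≤ G_ii, i.e. (ρP)_i ≤ ρ_i and ρ_i > 0. -/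
theorem stmt9
    (d : ℕ) (hd : 0 < d)
    (lam mu : Fin d → ℝ) (P : Fin d → Fin d → ℝ)
    (hlam : ∀ i, 0 ≤ lam i) (hmu : ∀ i, 0 < mu i)
    (hP : ∀ i j, 0 ≤ P i j) (hPdiag : ∀ i, P i i = 0) (hP0 : ∀ i, ∑ j, P i j ≤ 1)
    (hA : AssumptionA lam mu P)
    (G : Fin d → Fin d → ℝ)
    (hG1 : ∀ i k, ∑ j, G i j * ((if j = k then (1 : ℝ) else 0) - P j k)
      = if i = k then 1 else 0)
    (hG2 : ∀ i k, ∑ j, ((if i = j then (1 : ℝ) else 0) - P i j) * G j k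
      = if i = k then 1 else 0)
    (hGnn : ∀ i j, 0 ≤ G i j) (hGdiag : ∀ i, 1 ≤ G i i)
    (ν : Fin d → ℝ) (hν : ∀ j, ν j = lam j + ∑ i, ν i * P i j) (hνpos : ∀ i, 0 < ν i)
    (hB : Branching P) :
    ∀ i : Fin d, (∑ j, G j j * P j i ≤ G i i) ∧ 0 < G i i := by
  intro i
  refine ⟨?_, lt_of_lt_of_le one_pos (hGdiag i)⟩
  by_cases hex : ∃ j, 0 < P j i
  · obtain ⟨j, hj⟩ := hex
    have hzero : ∀ k, k ≠ j → P k i = 0 := fun k hk =>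
      le_antisymm (not_lt.1 fun h => hk (hB i k j h hj)) (hP k i)
    have hji : j ≠ i := by
      rintro rfl
      exact hj.ne' (hPdiag j)
    have hsum : ∀ f : Fin d → ℝ, ∑ k, f k * P k i = f j * P j i := fun f =>
      Fintype.sum_eq_single j fun k hk => by rw [hzero k hk, mul_zero]
    have h := hG1 j i
    simp only [mul_sub, Finset.sum_sub_distrib, hsum, mul_ite, mul_one, mul_zero,
      Finset.sum_ite_eq', Finset.mem_univ, if_true, if_neg hji] at h
    rw [hsum fun k => G k k]
    linarith [green_le_diag hP hP0 hG1 hG2 hGnn j i]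
  · push Not at hex
    have hz : ∀ j, P j i = 0 := fun j => le_antisymm (hex j) (hP j i)
    simpa [hz] using hGnn i i
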